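/- arXiv:quant-ph/0201029 — 4 statements merged into one kernel-verified Lean document; each statement's English description precedes it below -/
import Mathlib

section
/- Let l, r : ℝ^{4n} → ℝ^{2n} be given by l(x,y) = x - (1/2)Jy and r(x,y) = x + (1/2)Jy. Then the components of l and r satisfy, with respect to the secondary Poisson bracket, {l_α, l_β}_2 = J_{αβ}, {r_α, r_β}_2 = -J_{αβ}, and {l_α, r_β}_2 = 0 for all α, β = 1, …, 2n. -/
open Matrix MeasureTheory

noncomputable section

abbrev Vec (n : ℕ) := Fin (2*n) → ℝ

/-- The `2n×2n` symplectic matrix `J = [[0, Iₙ], [-Iₙ, 0]]`. -/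
def symJ (n : ℕ) : Matrix (Fin (2*n)) (Fin (2*n)) ℝ :=
  Matrix.of fun i j =>
    if i.val < n ∧ j.val = i.val + n then 1
    else if j.val < n ∧ i.val = j.val + n then -1 else 0

/-- Gradient of a scalar function on `ℝ^m`, as the vector of partial derivatives. -/
def grad {m : ℕ} (f : (Fin m → ℝ) → ℝ) (x : Fin m → ℝ) : Fin m → ℝ :=
  fun i => fderiv ℝ f x (Pi.single i 1)

/-- Primary Poisson bracket `{f,g}₁(x) = ∇f(x) · J ∇g(x)`. -/
def pb1 (n : ℕ) (f g : Vec n → ℝ) (x : Vec n) : ℝ :=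
  grad f x ⬝ᵥ (symJ n).mulVec (grad g x)

/-- `x`-gradient of a function on secondary phase space `ℝ^{2n} × ℝ^{2n}`. -/
def grad2x (n : ℕ) (F : Vec n × Vec n → ℝ) (z : Vec n × Vec n) : Vec n :=
  fun i => fderiv ℝ F z (Pi.single i 1, 0)

/-- `y`-gradient of a function on secondary phase space `ℝ^{2n} × ℝ^{2n}`. -/
def grad2y (n : ℕ) (F : Vec n × Vec n → ℝ) (z : Vec n × Vec n) : Vec n :=
  fun i => fderiv ℝ F z (0, Pi.single i 1)

/-- Secondary Poisson bracket `{F,G}₂(z) = ∇F(z) · J̃ ∇G(z)` with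
`J̃ = [[0, I_{2n}], [-I_{2n}, 0]]`, i.e. `∇ₓF·∇_yG - ∇_yF·∇ₓG`. -/
def pb2 (n : ℕ) (F G : Vec n × Vec n → ℝ) (z : Vec n × Vec n) : ℝ :=
  grad2x n F z ⬝ᵥ grad2y n G z - grad2y n F z ⬝ᵥ grad2x n G z

/-- Left projection `l(x,y) = x - (1/2) J y`. -/
def lmap (n : ℕ) (z : Vec n × Vec n) : Vec n := z.1 - (1/2 : ℝ) • (symJ n).mulVec z.2

/-- Right projection `r(x,y) = x + (1/2) J y`. -/
def rmap (n : ℕ) (z : Vec n × Vec n) : Vec n := z.1 + (1/2 : ℝ) • (symJ n).mulVec z.2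

/-- Hessian matrix of a scalar function on `ℝ^m`. -/
def hess {m : ℕ} (f : (Fin m → ℝ) → ℝ) (x : Fin m → ℝ) : Matrix (Fin m) (Fin m) ℝ :=
  Matrix.of fun i j => fderiv ℝ (fun y => fderiv ℝ f y (Pi.single j 1)) x (Pi.single i 1)

/-- Jacobian matrix of a map `ℝ^m → ℝ^m`. -/
def jac {m : ℕ} (f : (Fin m → ℝ) → (Fin m → ℝ)) (x : Fin m → ℝ) :
    Matrix (Fin m) (Fin m) ℝ :=
  Matrix.of fun i j => fderiv ℝ f x (Pi.single j 1) i

/-- Operator norm of a matrix acting on Euclidean space `ℝ^m`. -/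
def opNorm {m : ℕ} (A : Matrix (Fin m) (Fin m) ℝ) : ℝ :=
  ‖Matrix.toEuclideanCLM (𝕜 := ℝ) A‖

/-- Symplectic pairing `x ∧ y = x · J y`. -/
def wedgeP (n : ℕ) (x y : Vec n) : ℝ := x ⬝ᵥ (symJ n).mulVec y

theorem aux_fderiv (n : ℕ) (c : ℝ) (z v : Vec n × Vec n) (α : Fin (2*n)) :
    fderiv ℝ (fun w : Vec n × Vec n => w.1 α + c * ((symJ n).mulVec w.2 α)) z v
      = v.1 α + c * ((symJ n).mulVec v.2 α) := by
  let L : (Vec n × Vec n) →ₗ[ℝ] ℝ :=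
    { toFun := fun w => w.1 α + c * ((symJ n).mulVec w.2 α)
      map_add' := by
        intro a b
        simp only [Prod.fst_add, Prod.snd_add, Matrix.mulVec_add, Pi.add_apply]
        ring
      map_smul' := by
        intro a b
        simp only [Prod.smul_fst, Prod.smul_snd, Matrix.mulVec_smul, Pi.smul_apply, smul_eq_mul,
          RingHom.id_apply]
        ring }
  have h : (fun w : Vec n × Vec n => w.1 α + c * ((symJ n).mulVec w.2 α))
      = ⇑(LinearMap.toContinuousLinearMap L) := rfl
  rw [h, ContinuousLinearMap.fderiv]
  rfl

theorem aux_skew (n : ℕ) (α β : Fin (2*n)) : symJ n β α = - symJ n α β := by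
  simp only [symJ, Matrix.of_apply]
  split_ifs <;> first | omega | norm_num

theorem aux_pb (n : ℕ) (c d : ℝ) (z : Vec n × Vec n) (α β : Fin (2*n)) :
    pb2 n (fun w => w.1 α + c * ((symJ n).mulVec w.2 α))
      (fun w => w.1 β + d * ((symJ n).mulVec w.2 β)) z = -(c + d) * symJ n α β := by
  have h := aux_skew n α β
  simp only [pb2, grad2x, grad2y, aux_fderiv, dotProduct, Matrix.mulVec_zero, Pi.zero_apply,
    mul_zero, add_zero, zero_add, Matrix.mulVec_single_one, Matrix.col_apply, Pi.single_apply]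
  simp [h]
  ring

/-- secondary Poisson brackets of the components of the left and right
projections: `{l_α, l_β}₂ = J_{αβ}`, `{r_α, r_β}₂ = -J_{αβ}`, `{l_α, r_β}₂ = 0`. -/
theorem stmt0 (n : ℕ) (z : Vec n × Vec n) (α β : Fin (2*n)) :
    pb2 n (fun w => lmap n w α) (fun w => lmap n w β) z = symJ n α β ∧
    pb2 n (fun w => rmap n w α) (fun w => rmap n w β) z = -(symJ n α β) ∧
    pb2 n (fun w => lmap n w α) (fun w => rmap n w β) z = 0 := by
  have hl : ∀ γ, (fun w => lmap n w γ)
      = fun w : Vec n × Vec n => w.1 γ + (-(1/2)) * ((symJ n).mulVec w.2 γ) := by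
    intro γ
    funext w
    simp only [lmap, Pi.sub_apply, Pi.smul_apply, smul_eq_mul]
    ring
  have hr : ∀ γ, (fun w => rmap n w γ)
      = fun w : Vec n × Vec n => w.1 γ + (1/2) * ((symJ n).mulVec w.2 γ) := by
    intro γ
    funext w
    simp only [rmap, Pi.add_apply, Pi.smul_apply, smul_eq_mul]
  rw [hl, hl, hr, hr, aux_pb, aux_pb, aux_pb]
  refine ⟨?_, ?_, ?_⟩ <;> ring
end
end

section
/- Let l, r : ℝ^{4n} → ℝ^{2n} be given by l(x,y) = x - (1/2)Jy and r(x,y) = x + (1/2)Jy. For all continuously differentiable f, g : ℝ^{2n} → ℝ, the map l is Poisson and the map r is anti-Poisson: {f∘l, g∘l}_2 = {f,g}_1∘l and {f∘r, g∘r}_2 = -{f,g}_1∘r. -/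
open Matrix MeasureTheory

noncomputable section

lemma symJ_transpose (n : ℕ) : (symJ n)ᵀ = -symJ n := by
  ext i j
  simp only [symJ, Matrix.transpose_apply, Matrix.of_apply, Matrix.neg_apply]
  split_ifs <;> first | omega | simp

lemma fderiv_eq_grad {m : ℕ} (f : (Fin m → ℝ) → ℝ) (x v : Fin m → ℝ) :
    fderiv ℝ f x v = grad f x ⬝ᵥ v := by
  conv_lhs => rw [pi_eq_sum_univ' v]
  rw [map_sum]
  simp only [dotProduct, grad]
  refine Finset.sum_congr rfl fun i _ => ?_
  rw [map_smul, smul_eq_mul, mul_comm]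

/-- The map `(x, y) ↦ x + c J y` as a continuous linear map. -/
def cmap (n : ℕ) (c : ℝ) : Vec n × Vec n →L[ℝ] Vec n :=
  ContinuousLinearMap.fst ℝ _ _ +
    c • ((LinearMap.toContinuousLinearMap (Matrix.mulVecLin (symJ n))).comp
      (ContinuousLinearMap.snd ℝ (Vec n) (Vec n)))

lemma cmap_apply (n : ℕ) (c : ℝ) (z : Vec n × Vec n) :
    cmap n c z = z.1 + c • (symJ n).mulVec z.2 := by
  simp [cmap]

lemma fderiv_comp_cmap (n : ℕ) (c : ℝ) (f : Vec n → ℝ) (hf : ContDiff ℝ 1 f)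
    (z w : Vec n × Vec n) :
    fderiv ℝ (f ∘ cmap n c) z w = grad f (cmap n c z) ⬝ᵥ cmap n c w := by
  rw [fderiv_comp z (hf.differentiable (by norm_num) _) (cmap n c).differentiableAt,
    ContinuousLinearMap.fderiv, ContinuousLinearMap.comp_apply, fderiv_eq_grad]

lemma grad2x_comp (n : ℕ) (c : ℝ) (f : Vec n → ℝ) (hf : ContDiff ℝ 1 f) (z : Vec n × Vec n) :
    grad2x n (f ∘ cmap n c) z = grad f (cmap n c z) := by
  ext i
  rw [grad2x, fderiv_comp_cmap n c f hf, cmap_apply n c (Pi.single i 1, 0)]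
  simp

lemma grad2y_comp (n : ℕ) (c : ℝ) (f : Vec n → ℝ) (hf : ContDiff ℝ 1 f) (z : Vec n × Vec n) :
    grad2y n (f ∘ cmap n c) z = -(c • (symJ n).mulVec (grad f (cmap n c z))) := by
  ext i
  rw [grad2y, fderiv_comp_cmap n c f hf, cmap_apply n c (0, Pi.single i 1)]
  simp only [zero_add, dotProduct_smul, dotProduct_mulVec, dotProduct_single, mul_one]
  rw [← Matrix.mulVec_transpose, symJ_transpose, Matrix.neg_mulVec]
  simp

lemma pb2_comp (n : ℕ) (c : ℝ) (f g : Vec n → ℝ)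
    (hf : ContDiff ℝ 1 f) (hg : ContDiff ℝ 1 g) (z : Vec n × Vec n) :
    pb2 n (f ∘ cmap n c) (g ∘ cmap n c) z = -(2 * c) * pb1 n f g (cmap n c z) := by
  rw [pb2, pb1, grad2x_comp n c f hf, grad2x_comp n c g hg, grad2y_comp n c f hf,
    grad2y_comp n c g hg]
  have h : (symJ n).mulVec (grad f (cmap n c z)) ⬝ᵥ grad g (cmap n c z)
      = -(grad f (cmap n c z) ⬝ᵥ (symJ n).mulVec (grad g (cmap n c z))) := by
    rw [dotProduct_mulVec, ← Matrix.mulVec_transpose, symJ_transpose, Matrix.neg_mulVec,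
      neg_dotProduct, neg_neg]
  rw [dotProduct_neg, neg_dotProduct, dotProduct_smul, smul_dotProduct, h]
  simp only [smul_eq_mul]
  ring

/-- the left projection is Poisson and the right projection is anti-Poisson:
`{f∘l, g∘l}₂ = {f,g}₁ ∘ l` and `{f∘r, g∘r}₂ = -{f,g}₁ ∘ r`. -/
theorem stmt1 (n : ℕ) (f g : Vec n → ℝ)
    (hf : ContDiff ℝ 1 f) (hg : ContDiff ℝ 1 g) (z : Vec n × Vec n) :
    pb2 n (f ∘ lmap n) (g ∘ lmap n) z = pb1 n f g (lmap n z) ∧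
    pb2 n (f ∘ rmap n) (g ∘ rmap n) z = -(pb1 n f g (rmap n z)) := by
  have hl : lmap n = cmap n (-(1/2)) := by
    funext w
    rw [cmap_apply, lmap, neg_smul, sub_eq_add_neg]
  have hr : rmap n = cmap n (1/2) := by
    funext w
    rw [cmap_apply, rmap]
  rw [hl, hr, pb2_comp n _ f g hf hg, pb2_comp n _ f g hf hg]
  constructor <;> ring
end
end

section
/- Let H : ℝ^{2n} → ℝ be C² with Hessian bound ‖H''(x)‖ ≤ c₁ < ∞ uniformly in x, generating a globally defined Hamiltonian flow g(t|x) that is C¹ in (t,x), and let S₀ : ℝ^{2n} → ℝ be C² with ‖S₀''(x')‖ ≤ 2 uniformly in x'. Then there exists t₁ > 0 (any t₁ with 2(e^{c₁t₁} - 1) < 1 suffices) such that for every t ∈ [-t₁, t₁] the Heisenberg midpoint map M_t : ℝ^{2n} → ℝ^{2n} is a bijection of ℝ^{2n} onto itself; in particular, for every x ∈ ℝ^{2n} the boundary-condition equation M_t(x₀) = x has a unique solution x₀(t,x) = M_t^{-1}(x), and (t,x) ↦ x₀(t,x) is C¹ on [-t₁,t₁] × ℝ^{2n}. The same conclusion holds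 for the Schrödinger midpoint map M̃_t. -/
open Matrix MeasureTheory

noncomputable section

section abstractPart
variable {E : Type*} [NormedAddCommGroup E] [NormedSpace ℝ E]

theorem bij_of_near_id [CompleteSpace E] (f : E → E) (K : ℝ) (hK0 : 0 ≤ K) (hK : K < 1)
    (hf : ∀ x y, ‖(f x - x) - (f y - y)‖ ≤ K * ‖x - y‖) : Function.Bijective f := by
  constructor
  · intro x y h
    have h1 := hf x y
    rw [h] at h1
    have h2 : ‖x - y‖ ≤ K * ‖x - y‖ := by
      refine le_trans (le_of_eq ?_) h1
      rw [show f y - x - (f y - y) = -(x - y) by abel, norm_neg]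
    have h3 : ‖x - y‖ = 0 := by nlinarith [norm_nonneg (x - y)]
    exact sub_eq_zero.mp (norm_eq_zero.mp h3)
  · intro z
    have hc : ContractingWith ⟨K, hK0⟩ (fun x => z - (f x - x)) := by
      refine ⟨by exact_mod_cast hK, LipschitzWith.of_dist_le_mul fun x y => ?_⟩
      rw [dist_eq_norm, dist_eq_norm, norm_sub_rev]
      have := hf x y
      rw [sub_sub_sub_cancel_left]
      exact this
    refine ⟨hc.fixedPoint, ?_⟩
    have := hc.fixedPoint_isFixedPt
    unfold Function.IsFixedPt at this
    have h2 : z - f hc.fixedPoint = 0 := by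
      have h3 := congrArg (fun w => w - hc.fixedPoint) this
      simpa [sub_sub] using h3
    exact (sub_eq_zero.mp h2).symm

theorem inv_contDiff [FiniteDimensional ℝ E] (U : Set ℝ) (hU : IsOpen U)
    (M : ℝ → E → E) (hM : ContDiff ℝ 1 (fun p : ℝ × E => M p.1 p.2))
    (K : ℝ → ℝ) (hK0 : ∀ t ∈ U, 0 ≤ K t) (hK : ∀ t ∈ U, K t < 1)
    (hf : ∀ t ∈ U, ∀ x y, ‖(M t x - x) - (M t y - y)‖ ≤ K t * ‖x - y‖)
    (G : ℝ → E → E) (hG : ∀ t ∈ U, ∀ x, M t (G t x) = x) :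
    ContDiffOn ℝ 1 (fun p : ℝ × E => G p.1 p.2) (U ×ˢ Set.univ) := by
  have : CompleteSpace E := FiniteDimensional.complete ℝ E
  rintro ⟨t, x⟩ ⟨ht, -⟩
  apply ContDiffAt.contDiffWithinAt
  have ht : t ∈ U := ht
  set y := G t x with hy
  have hyx : M t y = x := hG t ht x
  let F : ℝ × E → ℝ × E := fun p => (p.1, M p.1 p.2)
  have hF : ContDiff ℝ 1 F := contDiff_fst.prodMk hM
  have hMd : HasFDerivAt (fun p : ℝ × E => M p.1 p.2)
      (fderiv ℝ (fun p : ℝ × E => M p.1 p.2) (t, y)) (t, y) :=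
    ((hM.differentiable one_ne_zero) (t, y)).hasFDerivAt
  set D := fderiv ℝ (fun p : ℝ × E => M p.1 p.2) (t, y) with hD
  have hFd : HasFDerivAt F ((ContinuousLinearMap.fst ℝ ℝ E).prod D) (t, y) :=
    hasFDerivAt_fst.prodMk hMd
  have hpart : HasFDerivAt (fun e => M t e - e)
      (D.comp (ContinuousLinearMap.inr ℝ ℝ E) - ContinuousLinearMap.id ℝ E) y := by
    have h1 : HasFDerivAt (fun e : E => ((t, e) : ℝ × E)) (ContinuousLinearMap.inr ℝ ℝ E) y :=
      hasFDerivAt_prodMk_right t y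
    exact (HasFDerivAt.comp y hMd h1).sub (hasFDerivAt_id y)
  have hle : ‖D.comp (ContinuousLinearMap.inr ℝ ℝ E) - ContinuousLinearMap.id ℝ E‖ ≤ K t := by
    refine hpart.le_of_lip' (hK0 t ht) (Filter.Eventually.of_forall fun e => ?_)
    exact hf t ht e y
  have hinj : Function.Injective ((ContinuousLinearMap.fst ℝ ℝ E).prod D) := by
    rw [injective_iff_map_eq_zero]
    rintro ⟨s, v⟩ h
    have h1 : s = 0 := congrArg Prod.fst h
    have h2 : D (s, v) = 0 := congrArg Prod.snd h
    subst h1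
    have h3 := (D.comp (ContinuousLinearMap.inr ℝ ℝ E) - ContinuousLinearMap.id ℝ E).le_of_opNorm_le
      hle v
    simp [h2] at h3
    have h4 : ‖v‖ = 0 := by nlinarith [norm_nonneg v, hK t ht]
    rw [norm_eq_zero.mp h4]; rfl
  let e : (ℝ × E) ≃L[ℝ] (ℝ × E) :=
    (LinearEquiv.ofInjectiveEndo ((ContinuousLinearMap.fst ℝ ℝ E).prod D : (ℝ × E) →ₗ[ℝ] (ℝ × E))
      hinj).toContinuousLinearEquiv
  have he : (e : (ℝ × E) →L[ℝ] (ℝ × E)) = (ContinuousLinearMap.fst ℝ ℝ E).prod D := by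
    ext1 <;> rfl
  have hFd' : HasFDerivAt F (e : (ℝ × E) →L[ℝ] (ℝ × E)) (t, y) := by rw [he]; exact hFd
  have hFa : ContDiffAt ℝ 1 F (t, y) := hF.contDiffAt
  have hloc := hFa.to_localInverse hFd' one_ne_zero
  have hstrict := hFa.hasStrictFDerivAt' hFd' one_ne_zero
  have hev := hstrict.eventually_right_inverse
  have hFy : F (t, y) = (t, x) := by simp [F, hyx]
  rw [hFy] at hloc hev
  refine (hloc.snd).congr_of_eventuallyEq ?_
  have hUn : ∀ᶠ p : ℝ × E in nhds (t, x), p.1 ∈ U :=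
    continuous_fst.continuousAt.eventually (hU.mem_nhds ht)
  filter_upwards [hev, hUn] with p hp hpU
  have hp1 := congrArg Prod.fst hp
  have hp2 := congrArg Prod.snd hp
  simp only [F] at hp1 hp2
  rw [hp1] at hp2
  exact (bij_of_near_id (M p.1) (K p.1) (hK0 _ hpU) (hK _ hpU) (hf _ hpU)).1
    ((hG p.1 hpU p.2).trans hp2.symm)

theorem gron (c : ℝ) (hc : 0 ≤ c) (z : ℝ → E) (z' : ℝ → E) (hz : ∀ t, HasDerivAt z (z' t) t)
    (hb : ∀ t, ‖z' t‖ ≤ c * ‖z t‖) (t : ℝ) :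
    ‖z t - z 0‖ ≤ (Real.exp (c * |t|) - 1) * ‖z 0‖ := by
  have key : ∀ (w w' : ℝ → E), (∀ t, HasDerivAt w (w' t) t) → (∀ t, ‖w' t‖ ≤ c * ‖w t‖) →
      ∀ t, 0 ≤ t → ‖w t - w 0‖ ≤ (Real.exp (c * t) - 1) * ‖w 0‖ := by
    intro w w' hw hb t ht
    have h := norm_le_gronwallBound_of_norm_deriv_right_le (f := fun s => w s - w 0) (f' := w')
      (δ := 0) (K := c) (ε := c * ‖w 0‖) (a := 0) (b := t)
      (fun s _ => ((hw s).sub_const _).continuousAt.continuousWithinAt)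
      (fun s _ => ((hw s).sub_const _).hasDerivWithinAt) (by simp)
      (fun s _ => by
        have h1 := hb s
        have h2 : ‖w s‖ ≤ ‖w s - w 0‖ + ‖w 0‖ := by
          simpa using norm_add_le (w s - w 0) (w 0)
        nlinarith) t ⟨ht, le_rfl⟩
    refine h.trans (le_of_eq ?_)
    rcases hc.eq_or_lt with h0 | h0
    · subst h0; simp [gronwallBound]
    · rw [gronwallBound_of_K_ne_0 h0.ne']
      field_simp
      simp
  rcases le_total 0 t with ht | ht
  · rw [abs_of_nonneg ht]; exact key z z' hz hb t ht
  · rw [abs_of_nonpos ht]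
    have := key (fun s => z (-s)) (fun s => -z' (-s))
      (fun s => by
        have := (hz (-s)).scomp s (hasDerivAt_neg s)
        simpa [Function.comp_def] using this)
      (fun s => by simpa using hb (-s)) (-t) (by linarith)
    simpa using this
end abstractPart

section euclid
/-- Euclidean version. -/
theorem grad_lip {m : ℕ} (f : (Fin m → ℝ) → ℝ) (hf : ContDiff ℝ 2 f) (c : ℝ)
    (hc : ∀ x, opNorm (hess f x) ≤ c) (x y : EuclideanSpace ℝ (Fin m)) :
    ‖WithLp.toLp 2 (grad f x.ofLp) - WithLp.toLp 2 (grad f y.ofLp)‖ ≤ c * ‖x - y‖ := by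
  have hd : ∀ e : EuclideanSpace ℝ (Fin m),
      HasFDerivAt (fun e : EuclideanSpace ℝ (Fin m) => WithLp.toLp 2 (grad f e.ofLp))
        (Matrix.toEuclideanCLM (𝕜 := ℝ) (hess f e.ofLp)ᵀ) e := by
    intro e
    have h0 : HasFDerivAt (grad f) (LinearMap.toContinuousLinearMap
        (Matrix.mulVecLin (hess f e.ofLp)ᵀ)) e.ofLp := by
      rw [hasFDerivAt_pi']
      intro j
      have h1 : Differentiable ℝ (fun y => fderiv ℝ f y (Pi.single j 1)) := by
        have : ContDiff ℝ 1 (fderiv ℝ f) := hf.fderiv_right (by norm_num)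
        exact (this.differentiable one_ne_zero).clm_apply (differentiable_const _)
      refine (h1 e.ofLp).hasFDerivAt.congr_fderiv ?_
      refine ContinuousLinearMap.coe_injective (LinearMap.pi_ext' fun i => LinearMap.ext_ring ?_)
      simp [hess]
    have h2 := ((EuclideanSpace.equiv (Fin m) ℝ).symm.toContinuousLinearMap.hasFDerivAt).comp e
      (h0.comp e (EuclideanSpace.equiv (Fin m) ℝ).toContinuousLinearMap.hasFDerivAt)
    refine h2.congr_fderiv ?_
    ext v
    rfl
  refine Convex.norm_image_sub_le_of_norm_hasFDerivWithin_le
    (f := fun e : EuclideanSpace ℝ (Fin m) => WithLp.toLp 2 (grad f e.ofLp)) (s := Set.univ)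
    (fun e _ => (hd e).hasFDerivWithinAt) ?_ convex_univ (Set.mem_univ _) (Set.mem_univ _)
  intro e _
  have := hc e.ofLp
  unfold opNorm at this
  rw [← Matrix.conjTranspose_eq_transpose_of_trivial, ← Matrix.star_eq_conjTranspose, map_star,
    norm_star]
  exact this

theorem symJ_norm (n : ℕ) (v : Vec n) :
    ‖WithLp.toLp 2 ((symJ n).mulVec v)‖ = ‖WithLp.toLp 2 v‖ := by
  let σ : Fin (2*n) → Fin (2*n) := fun i =>
    if h : i.val < n then ⟨i.val + n, by omega⟩ else ⟨i.val - n, by omega⟩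
  have hs1 : ∀ i : Fin (2*n), i.val < n → (σ i).val = i.val + n := fun i h => by simp [σ, h]
  have hs2 : ∀ i : Fin (2*n), ¬ i.val < n → (σ i).val = i.val - n := fun i h => by simp [σ, h]
  have hσ : Function.Involutive σ := by
    intro i
    ext
    by_cases h : i.val < n
    · have h1 := hs1 i h
      rw [hs2 _ (by omega), h1]; omega
    · have h1 := hs2 i h
      rw [hs1 _ (by omega), h1]; omega
  have hJ : ∀ i, ((symJ n).mulVec v i)^2 = (v (σ i))^2 := by
    intro i
    have : (symJ n).mulVec v i = (if i.val < n then 1 else -1) * v (σ i) := by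
      unfold Matrix.mulVec dotProduct
      rw [Finset.sum_eq_single (σ i)]
      · congr 1
        simp only [symJ, Matrix.of_apply]
        by_cases h : i.val < n
        · have h1 := hs1 i h
          rw [if_pos ⟨h, h1⟩, if_pos h]
        · have h1 := hs2 i h
          rw [if_neg (by omega), if_pos (by omega), if_neg h]
      · intro j _ hj
        have hj' : j.val ≠ (σ i).val := fun h => hj (Fin.ext h)
        have : symJ n i j = 0 := by
          simp only [symJ, Matrix.of_apply]
          by_cases h : i.val < n
          · have h1 := hs1 i h
            rw [if_neg (by omega), if_neg (by omega)]
          · have h1 := hs2 i h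
            rw [if_neg (by omega), if_neg (by omega)]
        simp [this]
      · simp
    rw [this, mul_pow]
    split_ifs <;> simp
  rw [EuclideanSpace.norm_eq, EuclideanSpace.norm_eq]
  congr 1
  simp only [Real.norm_eq_abs, sq_abs, hJ]
  exact Equiv.sum_comp hσ.toPerm (fun i => v i ^ 2)
end euclid

section final

theorem flow_lip (n : ℕ) (c₁ : ℝ) (hc : 0 ≤ c₁) (H : Vec n → ℝ) (hH : ContDiff ℝ 2 H)
    (hHess : ∀ x, opNorm (hess H x) ≤ c₁)
    (g : ℝ → Vec n → Vec n)
    (hg0 : ∀ x₀, g 0 x₀ = x₀)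
    (hgflow : ∀ x₀ τ, HasDerivAt (fun s => g s x₀) ((symJ n).mulVec (grad H (g τ x₀))) τ)
    (t : ℝ) (x y : Vec n) :
    ‖WithLp.toLp 2 ((g t x - x) - (g t y - y))‖ ≤
      (Real.exp (c₁ * |t|) - 1) * ‖WithLp.toLp 2 (x - y)‖ := by
  have hd : ∀ s, HasDerivAt (fun s => WithLp.toLp 2 (g s x - g s y))
      (WithLp.toLp 2 ((symJ n).mulVec (grad H (g s x)) - (symJ n).mulVec (grad H (g s y)))) s := by
    intro s
    have h := (hgflow x s).sub (hgflow y s)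
    exact ((EuclideanSpace.equiv (Fin (2*n)) ℝ).symm.toContinuousLinearMap.hasFDerivAt).comp_hasDerivAt
      s h
  have := gron c₁ hc _ _ hd (fun s => by
    rw [← Matrix.mulVec_sub, symJ_norm]
    exact grad_lip H hH c₁ hHess (WithLp.toLp 2 (g s x)) (WithLp.toLp 2 (g s y))) t
  simp only [hg0] at this
  rw [← WithLp.toLp_sub] at this
  rw [show (g t x - x) - (g t y - y) = (g t x - g t y) - (x - y) by abel]
  exact this

theorem phase_lip (n : ℕ) (S : Vec n → ℝ) (hS : ContDiff ℝ 2 S)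
    (hS'' : ∀ x', opNorm (hess S x') ≤ 2) (x y : Vec n) :
    ‖WithLp.toLp 2 ((1/2 : ℝ) • (symJ n).mulVec (grad S x) -
      (1/2 : ℝ) • (symJ n).mulVec (grad S y))‖ ≤ ‖WithLp.toLp 2 (x - y)‖ := by
  rw [← smul_sub, ← Matrix.mulVec_sub, WithLp.toLp_smul, norm_smul, symJ_norm]
  have := grad_lip S hS 2 hS'' (WithLp.toLp 2 x) (WithLp.toLp 2 y)
  rw [← WithLp.toLp_sub, ← WithLp.toLp_sub] at this
  norm_num
  norm_num at this
  linarith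

theorem phase_contDiff (n : ℕ) (S : Vec n → ℝ) (hS : ContDiff ℝ 2 S) :
    ContDiff ℝ 1 (fun x => (1/2 : ℝ) • (symJ n).mulVec (grad S x)) := by
  have h0 : ContDiff ℝ 1 (fderiv ℝ S) := hS.fderiv_right (by norm_num)
  have h1 : ContDiff ℝ 1 (grad S) := by
    rw [contDiff_pi]
    intro i
    exact h0.clm_apply contDiff_const
  have h2 : ContDiff ℝ 1 (fun v : Vec n => (symJ n).mulVec v) :=
    (LinearMap.toContinuousLinearMap (Matrix.mulVecLin (symJ n))).contDiff
  exact (h2.comp h1).const_smul _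

theorem finish (n : ℕ) (c₁ t₁ : ℝ) (hc : 0 ≤ c₁)
    (ht₁ : 2 * (Real.exp (c₁ * t₁) - 1) < 1)
    (M : ℝ → Vec n → Vec n) (hM : ContDiff ℝ 1 (fun p : ℝ × Vec n => M p.1 p.2))
    (hb : ∀ t x y, ‖WithLp.toLp 2 ((M t x - x) - (M t y - y))‖ ≤
      (2 * (Real.exp (c₁ * |t|) - 1)) * ‖WithLp.toLp 2 (x - y)‖) :
    (∀ t ∈ Set.Icc (-t₁) t₁, Function.Bijective (M t)) ∧
      (∃ x₀fun : ℝ → Vec n → Vec n,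
        ContDiffOn ℝ 1 (fun p : ℝ × Vec n => x₀fun p.1 p.2)
          (Set.Icc (-t₁) t₁ ×ˢ (Set.univ : Set (Vec n))) ∧
        ∀ t ∈ Set.Icc (-t₁) t₁, ∀ x : Vec n,
          M t (x₀fun t x) = x ∧ ∀ y, M t y = x → y = x₀fun t x) := by
  let L := EuclideanSpace.equiv (Fin (2*n)) ℝ
  let U : Set ℝ := {t | 2 * (Real.exp (c₁ * |t|) - 1) < 1}
  have hU : IsOpen U := isOpen_lt (by fun_prop) (by fun_prop)
  have hsub : Set.Icc (-t₁) t₁ ⊆ U := by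
    intro t ht
    have h1 : |t| ≤ t₁ := abs_le.mpr ht
    have h2 : Real.exp (c₁ * |t|) ≤ Real.exp (c₁ * t₁) :=
      Real.exp_le_exp.mpr (mul_le_mul_of_nonneg_left h1 hc)
    change 2 * (Real.exp (c₁ * |t|) - 1) < 1
    linarith
  let M' : ℝ → EuclideanSpace ℝ (Fin (2*n)) → EuclideanSpace ℝ (Fin (2*n)) :=
    fun t e => L.symm (M t (L e))
  let K : ℝ → ℝ := fun t => 2 * (Real.exp (c₁ * |t|) - 1)
  have hK0 : ∀ t ∈ U, 0 ≤ K t := by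
    intro t _
    have : 1 ≤ Real.exp (c₁ * |t|) := Real.one_le_exp (by positivity)
    change 0 ≤ 2 * (Real.exp (c₁ * |t|) - 1)
    linarith
  have hK : ∀ t ∈ U, K t < 1 := fun t ht => ht
  have hb' : ∀ t ∈ U, ∀ x y, ‖(M' t x - x) - (M' t y - y)‖ ≤ K t * ‖x - y‖ :=
    fun t _ x y => hb t (L x) (L y)
  have hM' : ContDiff ℝ 1 (fun p : ℝ × EuclideanSpace ℝ (Fin (2*n)) => M' p.1 p.2) :=
    L.symm.contDiff.comp (hM.comp (contDiff_fst.prodMk (L.contDiff.comp contDiff_snd)))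
  have hbij' : ∀ t ∈ U, Function.Bijective (M' t) := fun t ht =>
    bij_of_near_id (M' t) (K t) (hK0 t ht) (hK t ht) (hb' t ht)
  have hbij : ∀ t ∈ U, Function.Bijective (M t) := by
    intro t ht
    have h1 : M t = L ∘ M' t ∘ L.symm := by
      ext1 x
      simp [M']
    rw [h1]
    exact L.bijective.comp ((hbij' t ht).comp L.symm.bijective)
  refine ⟨fun t ht => hbij t (hsub ht), fun t => Function.invFun (M t), ?_, ?_⟩
  · have h := inv_contDiff U hU M' hM' K hK0 hK hb'
      (fun t e => L.symm (Function.invFun (M t) (L e)))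
      (fun t ht x => by
        have := Function.rightInverse_invFun (hbij t ht).2 (L x)
        simp [M', this])
    have h2 : ContDiffOn ℝ 1 (fun p : ℝ × Vec n =>
        L (L.symm (Function.invFun (M p.1) (L (L.symm p.2))))) (U ×ˢ Set.univ) := by
      refine L.contDiff.comp_contDiffOn (h.comp (t := U ×ˢ Set.univ)
        (contDiff_fst.prodMk (L.symm.contDiff.comp contDiff_snd)).contDiffOn ?_)
      exact fun p hp => ⟨hp.1, trivial⟩
    simp only [ContinuousLinearEquiv.apply_symm_apply] at h2
    exact h2.mono (Set.prod_mono hsub le_rfl)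
  · intro t ht x
    have h1 := Function.rightInverse_invFun (hbij t (hsub ht)).2 x
    exact ⟨h1, fun y hy => (hbij t (hsub ht)).1 (hy.trans h1.symm)⟩
end final

/-- under uniform bounds `‖H''‖ ≤ c₁` and `‖S₀''‖, ‖Φ₀''‖ ≤ 2`, there is `t₁ > 0`
(any `t₁` with `2(e^{c₁t₁} - 1) < 1` suffices) such that for `t ∈ [-t₁,t₁]` the Heisenberg and
Schrödinger midpoint maps are bijections of `ℝ^{2n}`, the boundary-condition equation has a
unique solution `x₀(t,x)`, and `(t,x) ↦ x₀(t,x)` is `C¹` on `[-t₁,t₁] × ℝ^{2n}`. -/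
theorem stmt6 (n : ℕ) (c₁ : ℝ) (H : Vec n → ℝ) (hH : ContDiff ℝ 2 H)
    (hHess : ∀ x, opNorm (hess H x) ≤ c₁)
    (g : ℝ → Vec n → Vec n)
    (hg0 : ∀ x₀, g 0 x₀ = x₀)
    (hgflow : ∀ x₀ τ, HasDerivAt (fun s => g s x₀) ((symJ n).mulVec (grad H (g τ x₀))) τ)
    (hgC1 : ContDiff ℝ 1 (fun p : ℝ × Vec n => g p.1 p.2))
    (S₀ Φ₀ : Vec n → ℝ) (hS₀ : ContDiff ℝ 2 S₀) (hΦ₀ : ContDiff ℝ 2 Φ₀)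
    (hS₀'' : ∀ x', opNorm (hess S₀ x') ≤ 2)
    (hΦ₀'' : ∀ x', opNorm (hess Φ₀ x') ≤ 2) :
    let M : ℝ → Vec n → Vec n := fun t x' =>
      (1/2 : ℝ) • (g t (x' - (1/2 : ℝ) • (symJ n).mulVec (grad S₀ x'))
        + g t (x' + (1/2 : ℝ) • (symJ n).mulVec (grad S₀ x')))
    let Msch : ℝ → Vec n → Vec n := fun t x' =>
      (1/2 : ℝ) • (g t (x' - (1/2 : ℝ) • (symJ n).mulVec (grad Φ₀ x'))
        + (x' + (1/2 : ℝ) • (symJ n).mulVec (grad Φ₀ x')))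
    (∃ t₁ : ℝ, 0 < t₁ ∧ 2 * (Real.exp (c₁ * t₁) - 1) < 1) ∧
    ∀ t₁ : ℝ, 0 < t₁ → 2 * (Real.exp (c₁ * t₁) - 1) < 1 →
      (∀ t ∈ Set.Icc (-t₁) t₁, Function.Bijective (M t) ∧ Function.Bijective (Msch t)) ∧
      (∃ x₀fun : ℝ → Vec n → Vec n,
        ContDiffOn ℝ 1 (fun p : ℝ × Vec n => x₀fun p.1 p.2)
          (Set.Icc (-t₁) t₁ ×ˢ (Set.univ : Set (Vec n))) ∧
        ∀ t ∈ Set.Icc (-t₁) t₁, ∀ x : Vec n,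
          M t (x₀fun t x) = x ∧ ∀ y, M t y = x → y = x₀fun t x) ∧
      (∃ x₀fun : ℝ → Vec n → Vec n,
        ContDiffOn ℝ 1 (fun p : ℝ × Vec n => x₀fun p.1 p.2)
          (Set.Icc (-t₁) t₁ ×ˢ (Set.univ : Set (Vec n))) ∧
        ∀ t ∈ Set.Icc (-t₁) t₁, ∀ x : Vec n,
          Msch t (x₀fun t x) = x ∧ ∀ y, Msch t y = x → y = x₀fun t x) := by
  intro M Msch
  have hc : 0 ≤ c₁ := (norm_nonneg _).trans (hHess 0)
  have hfl := flow_lip n c₁ hc H hH hHess g hg0 hgflow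
  refine ⟨⟨Real.log (5/4) / (c₁ + 1), ?_, ?_⟩, ?_⟩
  · have : 0 < Real.log (5/4) := Real.log_pos (by norm_num)
    positivity
  · have hl : 0 < Real.log (5/4) := Real.log_pos (by norm_num)
    have h1 : c₁ * (Real.log (5/4) / (c₁ + 1)) ≤ Real.log (5/4) := by
      rw [mul_div_assoc', div_le_iff₀ (by linarith)]
      nlinarith
    have h2 := Real.exp_le_exp.mpr h1
    rw [Real.exp_log (by norm_num)] at h2
    linarith
  intro t₁ _ ht₁
  have hk : ∀ t : ℝ, 0 ≤ Real.exp (c₁ * |t|) - 1 := fun t => by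
    have : 1 ≤ Real.exp (c₁ * |t|) := Real.one_le_exp (by positivity)
    linarith
  -- bounds for the shifted points
  have hl : ∀ (S : Vec n → ℝ), ContDiff ℝ 2 S → (∀ x', opNorm (hess S x') ≤ 2) → ∀ (t : ℝ) (x y : Vec n),
      ‖WithLp.toLp 2 ((g t (x - (1/2 : ℝ) • (symJ n).mulVec (grad S x))
          - (x - (1/2 : ℝ) • (symJ n).mulVec (grad S x)))
        - (g t (y - (1/2 : ℝ) • (symJ n).mulVec (grad S y))
          - (y - (1/2 : ℝ) • (symJ n).mulVec (grad S y))))‖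
      ≤ (2 * (Real.exp (c₁ * |t|) - 1)) * ‖WithLp.toLp 2 (x - y)‖ := by
    intro S hS hS2 t x y
    refine (hfl t _ _).trans ?_
    have h1 := phase_lip n S hS hS2 x y
    set a := (1/2 : ℝ) • (symJ n).mulVec (grad S x)
    set b := (1/2 : ℝ) • (symJ n).mulVec (grad S y)
    have h2 : ‖WithLp.toLp 2 ((x - a) - (y - b))‖ ≤ 2 * ‖WithLp.toLp 2 (x - y)‖ := by
      rw [show (x - a) - (y - b) = (x - y) - (a - b) by abel, WithLp.toLp_sub]
      refine (norm_sub_le _ _).trans ?_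
      linarith
    nlinarith [hk t]
  have hr : ∀ (S : Vec n → ℝ), ContDiff ℝ 2 S → (∀ x', opNorm (hess S x') ≤ 2) → ∀ (t : ℝ) (x y : Vec n),
      ‖WithLp.toLp 2 ((g t (x + (1/2 : ℝ) • (symJ n).mulVec (grad S x))
          - (x + (1/2 : ℝ) • (symJ n).mulVec (grad S x)))
        - (g t (y + (1/2 : ℝ) • (symJ n).mulVec (grad S y))
          - (y + (1/2 : ℝ) • (symJ n).mulVec (grad S y))))‖
      ≤ (2 * (Real.exp (c₁ * |t|) - 1)) * ‖WithLp.toLp 2 (x - y)‖ := by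
    intro S hS hS2 t x y
    refine (hfl t _ _).trans ?_
    have h1 := phase_lip n S hS hS2 x y
    set a := (1/2 : ℝ) • (symJ n).mulVec (grad S x)
    set b := (1/2 : ℝ) • (symJ n).mulVec (grad S y)
    have h2 : ‖WithLp.toLp 2 ((x + a) - (y + b))‖ ≤ 2 * ‖WithLp.toLp 2 (x - y)‖ := by
      rw [show (x + a) - (y + b) = (x - y) + (a - b) by abel, WithLp.toLp_add]
      refine (norm_add_le _ _).trans ?_
      linarith
    nlinarith [hk t]
  have hcl : ∀ (S : Vec n → ℝ), ContDiff ℝ 2 S → ContDiff ℝ 1 (fun p : ℝ × Vec n =>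
      g p.1 (p.2 - (1/2 : ℝ) • (symJ n).mulVec (grad S p.2))) := fun S hS =>
    hgC1.comp (contDiff_fst.prodMk (contDiff_snd.sub ((phase_contDiff n S hS).comp contDiff_snd)))
  have hcr : ∀ (S : Vec n → ℝ), ContDiff ℝ 2 S → ContDiff ℝ 1 (fun p : ℝ × Vec n =>
      p.2 + (1/2 : ℝ) • (symJ n).mulVec (grad S p.2)) := fun S hS =>
    contDiff_snd.add ((phase_contDiff n S hS).comp contDiff_snd)
  have hA := finish n c₁ t₁ hc ht₁ M
    (((hcl S₀ hS₀).add (hgC1.comp (contDiff_fst.prodMk (hcr S₀ hS₀)))).const_smul (1/2 : ℝ)) (by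
      intro t x y
      have h1 := hl S₀ hS₀ hS₀'' t x y
      have h2 := hr S₀ hS₀ hS₀'' t x y
      simp only [M]
      set a := (1/2 : ℝ) • (symJ n).mulVec (grad S₀ x)
      set b := (1/2 : ℝ) • (symJ n).mulVec (grad S₀ y)
      rw [show ((1/2 : ℝ) • (g t (x - a) + g t (x + a)) - x)
          - ((1/2 : ℝ) • (g t (y - b) + g t (y + b)) - y)
        = (1/2 : ℝ) • ((g t (x - a) - (x - a) - (g t (y - b) - (y - b)))
          + (g t (x + a) - (x + a) - (g t (y + b) - (y + b)))) by module,
        WithLp.toLp_smul, norm_smul, WithLp.toLp_add]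
      have h3 := norm_add_le (WithLp.toLp 2 (g t (x - a) - (x - a) - (g t (y - b) - (y - b))))
        (WithLp.toLp 2 (g t (x + a) - (x + a) - (g t (y + b) - (y + b))))
      rw [show ‖(1/2 : ℝ)‖ = 1/2 by norm_num]
      linarith)
  have hB := finish n c₁ t₁ hc ht₁ Msch
    (((hcl Φ₀ hΦ₀).add (hcr Φ₀ hΦ₀)).const_smul (1/2 : ℝ)) (by
      intro t x y
      have h1 := hl Φ₀ hΦ₀ hΦ₀'' t x y
      simp only [Msch]
      set a := (1/2 : ℝ) • (symJ n).mulVec (grad Φ₀ x)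
      set b := (1/2 : ℝ) • (symJ n).mulVec (grad Φ₀ y)
      rw [show ((1/2 : ℝ) • (g t (x - a) + (x + a)) - x)
          - ((1/2 : ℝ) • (g t (y - b) + (y + b)) - y)
        = (1/2 : ℝ) • (g t (x - a) - (x - a) - (g t (y - b) - (y - b))) by module,
        WithLp.toLp_smul, norm_smul]
      have h3 := norm_nonneg (WithLp.toLp 2 (g t (x - a) - (x - a) - (g t (y - b) - (y - b))))
      rw [show ‖(1/2 : ℝ)‖ = 1/2 by norm_num]
      linarith)
  exact ⟨fun t ht => ⟨hA.1 t ht, hB.1 t ht⟩, hA.2, hB.2⟩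
end
end

section
/- Let H : ℝ^{2n} → ℝ be C² with Hamiltonian flow g(t|x) that is C¹ in (t,x), and let S₀ : ℝ^{2n} → ℝ be C². For x' ∈ ℝ^{2n} write l' = x' - (1/2)J∇S₀(x'), r' = x' + (1/2)J∇S₀(x'), K_l = ∇g(t|l'), K_r = ∇g(t|r') (Jacobians of the flow with respect to the initial point). Then the Jacobian of the Heisenberg midpoint map is ∇M_t(x') = (1/2)[K_l(I - (1/2)JS₀''(x')) + K_r(I + (1/2)JS₀''(x'))]; equivalently, its (α,β) entry equals the secondary Poisson bracket {x(t)_α, η_β}_2 evaluated at the point (x', ∇S₀(x')) ∈ ℝ^{4n}, where η(x,y) = y - ∇S₀(x) and x(t|x,y) = (1/2)(g(t | x - (1/2)Jy) + g(t | x + (1/2)Jy)) is the position component of the extended Heisenberg flow. In particular det∇M_t(x') = det {x(t), η}_2(x', ∇S₀(x')). -/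
open Matrix MeasureTheory

noncomputable section

/-- A matrix as a continuous linear map. -/
def mclm {m : ℕ} (A : Matrix (Fin m) (Fin m) ℝ) : (Fin m → ℝ) →L[ℝ] (Fin m → ℝ) :=
  LinearMap.toContinuousLinearMap A.mulVecLin

lemma mclm_apply {m : ℕ} (A : Matrix (Fin m) (Fin m) ℝ) (v : Fin m → ℝ) :
    mclm A v = A.mulVec v := rfl

lemma mclm_hasFDerivAt {m : ℕ} {f : (Fin m → ℝ) → (Fin m → ℝ)} {x : Fin m → ℝ}
    (hf : DifferentiableAt ℝ f x) : HasFDerivAt f (mclm (jac f x)) x := by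
  have h : mclm (jac f x) = fderiv ℝ f x := by
    apply ContinuousLinearMap.coe_injective
    apply (Pi.basisFun ℝ (Fin m)).ext
    intro i
    ext j
    simp [mclm_apply, jac]
  rw [h]
  exact hf.hasFDerivAt

lemma jac_of_hasFDerivAt {m : ℕ} {f : (Fin m → ℝ) → (Fin m → ℝ)} {x : Fin m → ℝ}
    {L : (Fin m → ℝ) →L[ℝ] (Fin m → ℝ)} (A : Matrix (Fin m) (Fin m) ℝ)
    (h : HasFDerivAt f L x) (hA : ∀ v, L v = A.mulVec v) : jac f x = A := by
  ext i j
  simp [jac, h.fderiv, hA]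

lemma grad_diff {m : ℕ} {f : (Fin m → ℝ) → ℝ} (hf : ContDiff ℝ 2 f) :
    Differentiable ℝ (grad f) := by
  have h1 : ContDiff ℝ 1 (fderiv ℝ f) := hf.fderiv_right (by norm_num)
  have h2 : Differentiable ℝ (fderiv ℝ f) := h1.differentiable (by norm_num)
  unfold grad
  fun_prop

lemma jac_grad {m : ℕ} {f : (Fin m → ℝ) → ℝ} (hf : ContDiff ℝ 2 f) (x : Fin m → ℝ) :
    jac (grad f) x = (hess f x)ᵀ := by
  ext i j
  have h := ((grad_diff hf) x).hasFDerivAt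
  have h' := ((ContinuousLinearMap.proj (R := ℝ) (φ := fun _ : Fin m => ℝ) i).hasFDerivAt
    (x := grad f x)).comp x h
  have e := h'.fderiv
  simp only [jac, hess, transpose_apply, of_apply]
  have e2 : (fun y => fderiv ℝ f y (Pi.single i 1)) =
    (ContinuousLinearMap.proj (R := ℝ) (φ := fun _ : Fin m => ℝ) i) ∘ grad f := rfl
  rw [e2, e]
  rfl

lemma hess_symm {m : ℕ} {f : (Fin m → ℝ) → ℝ} (hf : ContDiff ℝ 2 f) (x : Fin m → ℝ) :
    (hess f x)ᵀ = hess f x := by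
  have h1 : ContDiff ℝ 1 (fderiv ℝ f) := hf.fderiv_right (by norm_num)
  have h2 : Differentiable ℝ (fderiv ℝ f) := h1.differentiable (by norm_num)
  have hs : IsSymmSndFDerivAt ℝ f x := hf.contDiffAt.isSymmSndFDerivAt (by simp)
  have key : ∀ v w, fderiv ℝ (fun y => fderiv ℝ f y v) x w = fderiv ℝ (fderiv ℝ f) x w v := by
    intro v w
    rw [fderiv_clm_apply (h2 x) (differentiableAt_const v)]
    simp
  ext i j
  simp only [hess, transpose_apply, of_apply, key]
  exact hs _ _

/-- the Jacobian of the Heisenberg midpoint map is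
`∇M_t(x') = (1/2)[K_l(I - (1/2)JS₀''(x')) + K_r(I + (1/2)JS₀''(x'))]`; its `(α,β)` entry equals
the secondary Poisson bracket `{x(t)_α, η_β}₂` at `(x', ∇S₀(x'))` where `η(x,y) = y - ∇S₀(x)`
and `x(t|x,y) = (1/2)(g(t|l) + g(t|r))`, and in particular
`det ∇M_t(x') = det {x(t), η}₂(x', ∇S₀(x'))`. -/
theorem stmt8 (n : ℕ) (H : Vec n → ℝ) (hH : ContDiff ℝ 2 H)
    (g : ℝ → Vec n → Vec n)
    (hg0 : ∀ x₀, g 0 x₀ = x₀)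
    (hgflow : ∀ x₀ τ, HasDerivAt (fun s => g s x₀) ((symJ n).mulVec (grad H (g τ x₀))) τ)
    (hgC1 : ContDiff ℝ 1 (fun p : ℝ × Vec n => g p.1 p.2))
    (S₀ : Vec n → ℝ) (hS₀ : ContDiff ℝ 2 S₀) (t : ℝ) (x' : Vec n) :
    let l' : Vec n := x' - (1/2 : ℝ) • (symJ n).mulVec (grad S₀ x')
    let r' : Vec n := x' + (1/2 : ℝ) • (symJ n).mulVec (grad S₀ x')
    let M : Vec n → Vec n := fun w =>
      (1/2 : ℝ) • (g t (w - (1/2 : ℝ) • (symJ n).mulVec (grad S₀ w))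
        + g t (w + (1/2 : ℝ) • (symJ n).mulVec (grad S₀ w)))
    let Kl : Matrix (Fin (2*n)) (Fin (2*n)) ℝ := jac (g t) l'
    let Kr : Matrix (Fin (2*n)) (Fin (2*n)) ℝ := jac (g t) r'
    let xflow : Vec n × Vec n → Vec n := fun z => (1/2 : ℝ) • (g t (lmap n z) + g t (rmap n z))
    let η : Vec n × Vec n → Vec n := fun z => z.2 - grad S₀ z.1
    jac M x' = (1/2 : ℝ) •
        (Kl * (1 - (1/2 : ℝ) • (symJ n * hess S₀ x'))
          + Kr * (1 + (1/2 : ℝ) • (symJ n * hess S₀ x'))) ∧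
    (∀ α β : Fin (2*n),
      jac M x' α β = pb2 n (fun z => xflow z α) (fun z => η z β) (x', grad S₀ x')) ∧
    (jac M x').det =
      (Matrix.of fun α β =>
        pb2 n (fun z => xflow z α) (fun z => η z β) (x', grad S₀ x')).det := by
  intro l' r' M Kl Kr xflow η
  have hgt : Differentiable ℝ (g t) := by
    have h := hgC1.differentiable (by norm_num)
    have : Differentiable ℝ (fun x : Vec n => (t, x)) := by fun_prop
    exact h.comp this
  have hG : HasFDerivAt (grad S₀) (mclm (hess S₀ x')) x' := by
    have h := mclm_hasFDerivAt ((grad_diff hS₀) x')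
    rwa [jac_grad hS₀, hess_symm hS₀] at h
  have hKl : HasFDerivAt (g t) (mclm Kl) l' := mclm_hasFDerivAt (hgt l')
  have hKr : HasFDerivAt (g t) (mclm Kr) r' := mclm_hasFDerivAt (hgt r')
  have hJG : HasFDerivAt (fun w => (1/2 : ℝ) • (symJ n).mulVec (grad S₀ w))
      ((1/2 : ℝ) • (mclm (symJ n)).comp (mclm (hess S₀ x'))) x' :=
    (((mclm (symJ n)).hasFDerivAt (x := grad S₀ x')).comp x' hG).const_smul (1/2 : ℝ)
  have hM1 : HasFDerivAt (fun w => g t (w - (1/2 : ℝ) • (symJ n).mulVec (grad S₀ w))) _ x' :=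
    HasFDerivAt.comp x' hKl ((hasFDerivAt_id x').sub hJG)
  have hM2 : HasFDerivAt (fun w => g t (w + (1/2 : ℝ) • (symJ n).mulVec (grad S₀ w))) _ x' :=
    HasFDerivAt.comp x' hKr ((hasFDerivAt_id x').add hJG)
  have hM : HasFDerivAt M _ x' := (hM1.add hM2).const_smul (1/2 : ℝ)
  have part1 : jac M x' = (1/2 : ℝ) •
        (Kl * (1 - (1/2 : ℝ) • (symJ n * hess S₀ x'))
          + Kr * (1 + (1/2 : ℝ) • (symJ n * hess S₀ x'))) := by
    refine jac_of_hasFDerivAt _ hM ?_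
    intro v
    simp [mclm_apply, Matrix.smul_mulVec, Matrix.add_mulVec, Matrix.sub_mulVec,
      ← Matrix.mulVec_mulVec, Matrix.mulVec_add, Matrix.mulVec_sub, Matrix.mulVec_smul]
  -- derivatives on the secondary phase space
  have hJ2 : HasFDerivAt (fun z : Vec n × Vec n => (1/2 : ℝ) • (symJ n).mulVec z.2)
      ((1/2 : ℝ) • (mclm (symJ n)).comp (ContinuousLinearMap.snd ℝ (Vec n) (Vec n)))
      (x', grad S₀ x') :=
    (((mclm (symJ n)).comp (ContinuousLinearMap.snd ℝ (Vec n) (Vec n))).hasFDerivAt).const_smul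
      (1/2 : ℝ)
  have hl : HasFDerivAt (lmap n) _ (x', grad S₀ x') := (hasFDerivAt_fst (𝕜 := ℝ)).sub hJ2
  have hr : HasFDerivAt (rmap n) _ (x', grad S₀ x') := (hasFDerivAt_fst (𝕜 := ℝ)).add hJ2
  have hx1 : HasFDerivAt (fun z => g t (lmap n z)) _ (x', grad S₀ x') :=
    HasFDerivAt.comp (x', grad S₀ x') (g := g t) (f := lmap n) hKl hl
  have hx2 : HasFDerivAt (fun z => g t (rmap n z)) _ (x', grad S₀ x') :=
    HasFDerivAt.comp (x', grad S₀ x') (g := g t) (f := rmap n) hKr hr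
  have hx : HasFDerivAt xflow _ (x', grad S₀ x') := (hx1.add hx2).const_smul (1/2 : ℝ)
  have hη : HasFDerivAt η _ (x', grad S₀ x') :=
    (hasFDerivAt_snd (𝕜 := ℝ)).sub
      (HasFDerivAt.comp (x', grad S₀ x') (g := grad S₀) (f := Prod.fst) hG
        (hasFDerivAt_fst (𝕜 := ℝ)))
  have part2 : ∀ α β : Fin (2*n),
      jac M x' α β = pb2 n (fun z => xflow z α) (fun z => η z β) (x', grad S₀ x') := by
    intro α β
    have hxα := (hasFDerivAt_pi'.1 hx) α
    have hηβ := (hasFDerivAt_pi'.1 hη) β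
    have a1 : grad2x n (fun z => xflow z α) (x', grad S₀ x')
        = fun i => ((1/2 : ℝ) • (Kl + Kr)) α i := by
      ext i
      simp [grad2x, hxα.fderiv, mclm_apply]
      ring
    have a2 : grad2y n (fun z => xflow z α) (x', grad S₀ x')
        = fun i => ((1/2 : ℝ) • (-((1/2 : ℝ) • (Kl * symJ n)) + (1/2 : ℝ) • (Kr * symJ n))) α i := by
      ext i
      have e1 : Kl.mulVec ((symJ n).mulVec (Pi.single i 1)) α = (Kl * symJ n) α i := by
        rw [Matrix.mulVec_mulVec, Matrix.mulVec_single_one]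
        rfl
      have e2 : Kr.mulVec ((symJ n).mulVec (Pi.single i 1)) α = (Kr * symJ n) α i := by
        rw [Matrix.mulVec_mulVec, Matrix.mulVec_single_one]
        rfl
      have e3 : grad2y n (fun z => xflow z α) (x', grad S₀ x') i
          = (1/2 : ℝ) * (Kl.mulVec (0 - (1/2 : ℝ) • (symJ n).mulVec (Pi.single i 1)) α
            + Kr.mulVec (0 + (1/2 : ℝ) • (symJ n).mulVec (Pi.single i 1)) α) := by
        rw [grad2y, hxα.fderiv]
        rfl
      rw [e3, zero_sub, zero_add, Matrix.mulVec_neg, Matrix.mulVec_smul, Matrix.mulVec_smul]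
      simp only [Pi.neg_apply, Pi.smul_apply, e1, e2, Matrix.smul_apply, Matrix.add_apply,
        Matrix.neg_apply, smul_eq_mul]
    have a3 : grad2x n (fun z => η z β) (x', grad S₀ x') = fun i => - hess S₀ x' i β := by
      ext i
      simp [grad2x, hηβ.fderiv, mclm_apply]
      exact congrFun (congrFun (hess_symm hS₀ x') i) β
    have a4 : grad2y n (fun z => η z β) (x', grad S₀ x')
        = fun i => (1 : Matrix (Fin (2*n)) (Fin (2*n)) ℝ) i β := by
      ext i
      simp [grad2y, hηβ.fderiv, mclm_apply, Matrix.one_apply, Pi.single_apply, eq_comm]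
    have key : pb2 n (fun z => xflow z α) (fun z => η z β) (x', grad S₀ x')
        = (((1/2 : ℝ) • (Kl + Kr)) * 1 -
          ((1/2 : ℝ) • (-((1/2 : ℝ) • (Kl * symJ n)) + (1/2 : ℝ) • (Kr * symJ n)))
            * (-hess S₀ x') : Matrix (Fin (2*n)) (Fin (2*n)) ℝ) α β := by
      rw [pb2, a1, a2, a3, a4]
      rfl
    rw [key, part1]
    refine congrArg (fun A : Matrix (Fin (2*n)) (Fin (2*n)) ℝ => A α β) ?_
    simp only [Matrix.mul_add, Matrix.mul_sub, Matrix.add_mul, Matrix.smul_mul, Matrix.mul_smul,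
      Matrix.mul_neg, Matrix.neg_mul, Matrix.mul_one, Matrix.mul_assoc]
    module
  refine ⟨part1, part2, ?_⟩
  congr 1
  ext α β
  exact part2 α β
end
end
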